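/- arXiv:2309.04728 — 7 statements merged into one kernel-verified Lean document; each statement's English description precedes it below -/
import Mathlib

section
/- Every point of X_0(v) lies on an entire solution: for each x₀ ∈ X_0(v) there exists an entire solution x : ℤ → X for input v with x(0) = x₀. -/
/-- The pullback composition `f_{v(k-1)} ∘ f_{v(k-2)} ∘ ⋯ ∘ f_{v(k-n)}` of the driven
system, over `n` steps ending at time `k`. -/
def pullComp {d M : ℕ}
    (f : Fin M → EuclideanSpace ℝ (Fin d) → EuclideanSpace ℝ (Fin d))
    (v : ℤ → Fin M) (k : ℤ) :
    ℕ → (EuclideanSpace ℝ (Fin d) → EuclideanSpace ℝ (Fin d))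
  | 0 => id
  | (n + 1) => pullComp f v k n ∘ f (v (k - (n + 1)))

/-- An entire solution for input `v`: a bi-infinite trajectory in `X` of the driven system. -/
def IsEntireSolution {d M : ℕ} (X : Set (EuclideanSpace ℝ (Fin d)))
    (f : Fin M → EuclideanSpace ℝ (Fin d) → EuclideanSpace ℝ (Fin d))
    (v : ℤ → Fin M) (x : ℤ → EuclideanSpace ℝ (Fin d)) : Prop :=
  (∀ k : ℤ, x k ∈ X) ∧ ∀ k : ℤ, x (k + 1) = f (v k) (x k)

/-- Every point of `X` starts a forward orbit, extended arbitrarily inside `X` to earlier times. -/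
theorem exists_forward_orbit {d M : ℕ} {X : Set (EuclideanSpace ℝ (Fin d))}
    {f : Fin M → EuclideanSpace ℝ (Fin d) → EuclideanSpace ℝ (Fin d)}
    (hfmap : ∀ i, Set.MapsTo (f i) X X) (v : ℤ → Fin M) (k : ℤ)
    {y : EuclideanSpace ℝ (Fin d)} (hy : y ∈ X) :
    ∃ x : ℤ → EuclideanSpace ℝ (Fin d), (∀ j, x j ∈ X) ∧
      (∀ j ≥ k, x (j + 1) = f (v j) (x j)) ∧ x k = y := by
  let orbit : ℕ → EuclideanSpace ℝ (Fin d) := fun m => Nat.rec y (fun m z => f (v (k + m)) z) m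
  have horbit : ∀ m, orbit m ∈ X := by
    intro m
    induction m with
    | zero => exact hy
    | succ m ih => exact hfmap _ ih
  refine ⟨fun j => orbit (j - k).toNat, fun j => horbit _, fun j hj => ?_, by simp [orbit]⟩
  obtain ⟨m, rfl⟩ := Int.le.dest hj
  have h₁ : (k + m + 1 - k).toNat = m + 1 := by omega
  have h₂ : (k + m - k).toNat = m := by omega
  simp only [h₁, h₂, orbit]

/-- A pullback composition applied to a point of `X` is the value at time `k` of a sequence
in `X` that follows the dynamics from time `k - n` on. -/
theorem exists_orbit_through_pullComp {d M : ℕ} {X : Set (EuclideanSpace ℝ (Fin d))}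
    {f : Fin M → EuclideanSpace ℝ (Fin d) → EuclideanSpace ℝ (Fin d)}
    (hfmap : ∀ i, Set.MapsTo (f i) X X) (v : ℤ → Fin M) (k : ℤ) (n : ℕ)
    {y : EuclideanSpace ℝ (Fin d)} (hy : y ∈ X) :
    ∃ x : ℤ → EuclideanSpace ℝ (Fin d), (∀ j, x j ∈ X) ∧
      (∀ j ≥ k - n, x (j + 1) = f (v j) (x j)) ∧ x (k - n) = y ∧
      x k = pullComp f v k n y := by
  induction n generalizing y with
  | zero =>
    obtain ⟨x, hxX, hx, hxk⟩ := exists_forward_orbit hfmap v k hy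
    exact ⟨x, hxX, by simpa using hx, by simpa using hxk, hxk⟩
  | succ n ih =>
    obtain ⟨x, hxX, hx, hxn, hxk⟩ := ih (hfmap (v (k - (n + 1))) hy)
    refine ⟨Function.update x (k - (n + 1)) y, fun j => ?_, fun j hj => ?_, by simp, ?_⟩
    · rcases eq_or_ne j (k - (n + 1)) with rfl | hne
      · simpa using hy
      · simpa [Function.update_of_ne hne] using hxX j
    · push_cast at hj
      rw [Function.update_of_ne (by omega)]
      rcases eq_or_ne j (k - (n + 1)) with rfl | hne
      · rw [Function.update_self, ← hxn]
        congr 1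
        ring
      · rw [Function.update_of_ne hne]
        exact hx j (by omega)
    · rw [Function.update_of_ne (by omega), hxk]
      rfl

/-- every point of `X_0(v) = ⋂_{n ≥ 1} X_{−n,0}(v)` lies on an entire
solution for input `v`. -/
theorem mem_pullback_intersection_lies_on_entire_solution
    {d M : ℕ} (X : Set (EuclideanSpace ℝ (Fin d)))
    (hXne : X.Nonempty) (hXcomp : IsCompact X)
    (f : Fin M → EuclideanSpace ℝ (Fin d) → EuclideanSpace ℝ (Fin d))
    (hfc : ∀ i, Continuous (f i)) (hfmap : ∀ i, Set.MapsTo (f i) X X)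
    (v : ℤ → Fin M) :
    ∀ x₀ ∈ ⋂ n ≥ 1, pullComp f v 0 n '' X,
      ∃ x : ℤ → EuclideanSpace ℝ (Fin d),
        IsEntireSolution X f v x ∧ x 0 = x₀ := by
  intro x₀ hx₀
  let C : ℕ → Set (ℤ → EuclideanSpace ℝ (Fin d)) := fun n =>
    {x | (∀ k, x k ∈ X) ∧ (∀ k ≥ -(n : ℤ), x (k + 1) = f (v k) (x k)) ∧ x 0 = x₀}
  have hclosed : ∀ n, IsClosed (C n) := by
    intro n
    simp only [C, Set.ofPred_and, Set.ofPred_forall]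
    refine (isClosed_iInter fun k => hXcomp.isClosed.preimage (continuous_apply k)).inter
      (IsClosed.inter (isClosed_iInter fun k => isClosed_iInter fun _ =>
        isClosed_eq (continuous_apply _) ((hfc _).comp (continuous_apply k)))
        (isClosed_eq (continuous_apply 0) continuous_const))
  have hcompact : IsCompact (C 0) :=
    (isCompact_univ_pi fun _ : ℤ => hXcomp).of_isClosed_subset (hclosed 0)
      fun x hx k _ => hx.1 k
  have hanti : ∀ n, C (n + 1) ⊆ C n := fun n x hx =>
    ⟨hx.1, fun k hk => hx.2.1 k (by push_cast; omega), hx.2.2⟩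
  have hne : ∀ n, (C n).Nonempty := by
    intro n
    obtain ⟨y, hy, hyx⟩ := Set.mem_iInter₂.mp hx₀ (n + 1) (by omega)
    obtain ⟨x, hxX, hx, -, hx0⟩ := exists_orbit_through_pullComp hfmap v 0 (n + 1) hy
    exact ⟨x, hxX, fun k hk => hx k (by push_cast; omega), hx0.trans hyx⟩
  obtain ⟨x, hx⟩ := IsCompact.nonempty_iInter_of_sequence_nonempty_isCompact_isClosed C hanti
    hne hcompact hclosed
  rw [Set.mem_iInter] at hx
  exact ⟨x, ⟨(hx 0).1, fun k => (hx k.natAbs).2.1 k (by omega)⟩, (hx 0).2.2⟩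
end

section
/- There exist an integer m_min ≥ 1 and a radius ε > 0 such that for every input sequence v : ℤ → U with minimum repetitions ≥ m_min and every entire attractor sequence A for v, there is an entire solution x for input v with x(k) ∈ B_{v(k+1)}^{A(k+1)} for all k ∈ ℤ, and x is pullback attracting along the attractor sequence: for every k ∈ ℤ, sup { |(f_{v(k−1)} ∘ f_{v(k−2)} ∘ ⋯ ∘ f_{v(k−n)})(y) − x(k)| : |y − x_{v(k−n)}^{A(k−n)}| ≤ ε } → 0 as n → ∞. -/
/-- The basin of attraction, within `X`, of the point `p` under the map `g`. -/
def basinOf {d : ℕ} (X : Set (EuclideanSpace ℝ (Fin d)))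
    (g : EuclideanSpace ℝ (Fin d) → EuclideanSpace ℝ (Fin d))
    (p : EuclideanSpace ℝ (Fin d)) : Set (EuclideanSpace ℝ (Fin d)) :=
  {y ∈ X | Filter.Tendsto (fun n : ℕ => g^[n] y) Filter.atTop (nhds p)}

/-- `v` has minimum repetitions `≥ m`: every maximal constant block of `v` has length at
least `m`. -/
def MinRepetitions {M : ℕ} (v : ℤ → Fin M) (m : ℕ) : Prop :=
  ∀ k : ℤ, v k ≠ v (k + 1) → ∀ j : ℕ, 1 ≤ j → j ≤ m → v (k + j) = v (k + 1)

open Filter Topology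
open scoped NNReal

theorem contDiff_iterate {E : Type*} [NormedAddCommGroup E] [NormedSpace ℝ E] {g : E → E}
    {r : WithTop ℕ∞} (hg : ContDiff ℝ r g) (n : ℕ) : ContDiff ℝ r g^[n] := by
  induction n with
  | zero => exact contDiff_id
  | succ n ih => exact ih.comp hg

/-- A `C¹` map has Lipschitz iterates with constants tending to zero near a fixed point at which
some power of its derivative is a strict contraction. -/
theorem exists_nhds_lipschitzOnWith_iterate_of_fixed
    {E : Type*} [NormedAddCommGroup E] [NormedSpace ℝ E] {g : E → E} {q : E} {N : ℕ}
    (hg : ContDiff ℝ 1 g) (hq : g q = q) (hN : 1 ≤ N) (hyp : ‖(fderiv ℝ g q) ^ N‖ < 1) :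
    ∃ s ∈ 𝓝 q, ∃ c : ℕ → ℝ≥0, Tendsto c atTop (𝓝 0) ∧
      ∀ n, LipschitzOnWith (c n) g^[n] s := by
  have hstrict : HasStrictFDerivAt g^[N] ((fderiv ℝ g q) ^ N) q :=
    (hg.hasStrictFDerivAt one_ne_zero).iterate hq N
  obtain ⟨κ, hκ, hκ1⟩ := exists_between (show ‖(fderiv ℝ g q) ^ N‖₊ < 1 from hyp)
  obtain ⟨u, hu, hlip⟩ := hstrict.exists_lipschitzOnWith_of_nnnorm_lt κ hκ
  have hloc : ∀ b : ℕ, ∃ K : ℝ≥0, ∃ t ∈ 𝓝 q, LipschitzOnWith K g^[b] t := fun b =>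
    (contDiff_iterate hg b).contDiffAt.exists_lipschitzOnWith
  choose K t ht hK using hloc
  have hmem : u ∩ ⋂ b ∈ Set.Iio N, t b ∈ 𝓝 q :=
    inter_mem hu ((biInter_mem (Set.finite_Iio N)).2 fun b _ => ht b)
  obtain ⟨δ, hδ, hsub⟩ := Metric.nhds_basis_closedBall.mem_iff.1 hmem
  have hfix : g^[N] q = q := Function.iterate_fixed hq N
  have hball : LipschitzOnWith κ g^[N] (Metric.closedBall q δ) :=
    hlip.mono (hsub.trans Set.inter_subset_left)
  have hmaps : Set.MapsTo g^[N] (Metric.closedBall q δ) (Metric.closedBall q δ) := by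
    intro y hy
    have h := hball.dist_le_mul y hy q (Metric.mem_closedBall_self hδ.le)
    rw [hfix] at h
    have hκ' : (κ : ℝ) ≤ 1 := by exact_mod_cast hκ1.le
    exact h.trans ((mul_le_of_le_one_left dist_nonneg hκ').trans hy)
  have hpow : ∀ a, LipschitzOnWith (κ ^ a) (g^[N])^[a] (Metric.closedBall q δ) := by
    intro a
    induction a with
    | zero => simpa using LipschitzWith.id.lipschitzOnWith
    | succ a ih =>
      rw [Function.iterate_succ, pow_succ]
      exact ih.comp hball hmaps
  refine ⟨_, Metric.closedBall_mem_nhds q hδ,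
    fun n => (∑ b ∈ Finset.range N, K b) * κ ^ (n / N), ?_, fun n => ?_⟩
  · have h1 : Tendsto (fun n => κ ^ (n / N)) atTop (𝓝 0) :=
      (tendsto_pow_atTop_nhds_zero_of_lt_one zero_le hκ1).comp
        (Nat.tendsto_div_const_atTop (by omega))
    simpa using h1.const_mul (∑ b ∈ Finset.range N, K b)
  · have hb : n % N < N := Nat.mod_lt _ hN
    have hKb : LipschitzOnWith (∑ b ∈ Finset.range N, K b) g^[n % N] (Metric.closedBall q δ) :=
      ((hK (n % N)).mono fun y hy => Set.mem_iInter₂.1 (hsub hy).2 _ hb).weaken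
        (Finset.single_le_sum (f := K) (fun _ _ => zero_le) (Finset.mem_range.2 hb))
    have h := hKb.comp (hpow (n / N)) (hmaps.iterate _)
    rwa [← Function.iterate_mul, ← Function.iterate_add, Nat.mod_add_div] at h

/-- Iterates of a `C¹` map have Lipschitz constants tending to zero near any point whose orbit
converges to a hyperbolically stable fixed point. -/
theorem exists_nhds_lipschitzOnWith_iterate_of_tendsto
    {E : Type*} [NormedAddCommGroup E] [NormedSpace ℝ E] {g : E → E} {p q : E} {N : ℕ}
    (hg : ContDiff ℝ 1 g) (hq : g q = q) (hN : 1 ≤ N) (hyp : ‖(fderiv ℝ g q) ^ N‖ < 1)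
    (hp : Tendsto (fun n => g^[n] p) atTop (𝓝 q)) :
    ∃ s ∈ 𝓝 p, ∃ c : ℕ → ℝ≥0, Tendsto c atTop (𝓝 0) ∧
      ∀ n, LipschitzOnWith (c n) g^[n] s := by
  obtain ⟨s, hs, c, hc, hlip⟩ := exists_nhds_lipschitzOnWith_iterate_of_fixed hg hq hN hyp
  obtain ⟨T, hT⟩ := (hp.eventually (eventually_mem_nhds_iff.2 hs)).exists
  have hloc : ∀ b : ℕ, ∃ K : ℝ≥0, ∃ t ∈ 𝓝 p, LipschitzOnWith K g^[b] t := fun b =>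
    (contDiff_iterate hg b).contDiffAt.exists_lipschitzOnWith
  choose K t ht hK using hloc
  refine ⟨(g^[T] ⁻¹' s) ∩ ⋂ b ∈ Set.Iic T, t b,
    inter_mem ((hg.continuous.iterate T).continuousAt hT)
      ((biInter_mem (Set.finite_Iic T)).2 fun b _ => ht b),
    fun n => if n ≤ T then K n else c (n - T) * K T, ?_, fun n => ?_⟩
  · have h1 : Tendsto (fun n => c (n - T) * K T) atTop (𝓝 0) := by
      simpa using (hc.comp (tendsto_sub_atTop_nat T)).mul_const (K T)
    refine h1.congr' ?_
    filter_upwards [eventually_gt_atTop T] with n hn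
    rw [if_neg hn.not_ge]
  · by_cases hn : n ≤ T
    · simp only [hn, if_true]
      exact (hK n).mono fun y hy => Set.mem_iInter₂.1 hy.2 n hn
    · simp only [hn, if_false]
      have h := (hlip (n - T)).comp
        ((hK T).mono fun y hy => Set.mem_iInter₂.1 hy.2 T (Set.mem_Iic.2 le_rfl))
        (fun y (hy : y ∈ (g^[T] ⁻¹' s) ∩ ⋂ b ∈ Set.Iic T, t b) => hy.1)
      rwa [← Function.iterate_add, Nat.sub_add_cancel (not_le.1 hn).le] at h

/-- Composing pullbacks over consecutive stretches of time. -/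
theorem pullComp_add {d M : ℕ}
    (f : Fin M → EuclideanSpace ℝ (Fin d) → EuclideanSpace ℝ (Fin d))
    (v : ℤ → Fin M) (k : ℤ) (a b : ℕ) :
    pullComp f v k (a + b) = pullComp f v k a ∘ pullComp f v (k - a) b := by
  induction b with
  | zero => rfl
  | succ b ih =>
    rw [← add_assoc, pullComp, ih, pullComp, Function.comp_assoc]
    congr 4
    push_cast
    ring

/-- Over a stretch of constant input the pullback is an iterate. -/
theorem pullComp_eq_iterate {d M : ℕ}
    (f : Fin M → EuclideanSpace ℝ (Fin d) → EuclideanSpace ℝ (Fin d))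
    (v : ℤ → Fin M) (k : ℤ) (u : Fin M) (n : ℕ)
    (h : ∀ i : ℕ, 1 ≤ i → i ≤ n → v (k - i) = u) :
    pullComp f v k n = (f u)^[n] := by
  induction n with
  | zero => rfl
  | succ n ih =>
    have h1 := h (n + 1) (by omega) le_rfl
    push_cast at h1
    rw [pullComp, ih fun i hi hin => h i hi (by omega), h1, Function.iterate_succ]

theorem continuous_pullComp {d M : ℕ}
    {f : Fin M → EuclideanSpace ℝ (Fin d) → EuclideanSpace ℝ (Fin d)}
    (hf : ∀ i, Continuous (f i)) (v : ℤ → Fin M) (k : ℤ) (n : ℕ) :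
    Continuous (pullComp f v k n) := by
  induction n with
  | zero => exact continuous_id
  | succ n ih => exact ih.comp (hf _)

theorem mapsTo_pullComp {d M : ℕ}
    {f : Fin M → EuclideanSpace ℝ (Fin d) → EuclideanSpace ℝ (Fin d)}
    {X : Set (EuclideanSpace ℝ (Fin d))}
    (hf : ∀ i, Set.MapsTo (f i) X X) (v : ℤ → Fin M) (k : ℤ) (n : ℕ) :
    Set.MapsTo (pullComp f v k n) X X := by
  induction n with
  | zero => exact Set.mapsTo_id X
  | succ n ih => exact ih.comp (hf _)

/-- The input `v` is constant over the `m` steps immediately before time `k`. -/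
def ConstBefore {M : ℕ} (v : ℤ → Fin M) (m : ℕ) (k : ℤ) : Prop :=
  ∀ i : ℕ, 1 ≤ i → i ≤ m → v (k - i) = v (k - 1)

theorem MinRepetitions.mono {M : ℕ} {v : ℤ → Fin M} {m n : ℕ} (hv : MinRepetitions v n)
    (h : m ≤ n) : MinRepetitions v m :=
  fun k hk j hj hjm => hv k hk j hj (hjm.trans h)

/-- A failure of constancy before `k` is witnessed by a last switch. -/
theorem exists_switch_of_not_constBefore {M : ℕ} {v : ℤ → Fin M} {m : ℕ} {k : ℤ}
    (h : ¬ ConstBefore v m k) :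
    ∃ j : ℕ, 1 ≤ j ∧ j < m ∧ v (k - j - 1) ≠ v (k - j) ∧
      ∀ i : ℕ, 1 ≤ i → i ≤ j → v (k - i) = v (k - 1) := by
  induction m with
  | zero => exact (h fun i hi him => by omega).elim
  | succ m ih =>
    by_cases hm : ConstBefore v m k
    · have hne : v (k - (m + 1 : ℕ)) ≠ v (k - 1) := fun he => h fun i hi him => by
        rcases Nat.lt_or_ge m i with hlt | hle
        · obtain rfl : i = m + 1 := by omega
          exact he
        · exact hm i hi hle
      rcases Nat.eq_zero_or_pos m with rfl | hpos
      · exact (hne (by simp)).elim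
      · refine ⟨m, hpos, by omega, ?_, hm⟩
        rw [hm m hpos le_rfl]
        rwa [Nat.cast_succ, ← sub_sub] at hne
    · obtain ⟨j, hj, hjm, h1, h2⟩ := ih hm
      exact ⟨j, hj, by omega, h1, h2⟩

theorem MinRepetitions.constBefore_of_switch {M : ℕ} {v : ℤ → Fin M} {m : ℕ}
    (hv : MinRepetitions v m) {k : ℤ} (hk : v (k - 1) ≠ v k) : ConstBefore v m k := by
  by_contra h
  obtain ⟨j, hj, hjm, hsw, hc⟩ := exists_switch_of_not_constBefore h
  have h1 := hv (k - j - 1) (by rwa [sub_add_cancel]) (j + 1) (by omega) (by omega)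
  rw [sub_add_cancel, hc j hj le_rfl] at h1
  refine hk (h1.symm.trans ?_)
  congr 1
  push_cast
  ring

/-- Shortly before any time `k` there is a time in the same constant block of the input which is
preceded by `m` steps of constant input. -/
theorem MinRepetitions.exists_constBefore {M : ℕ} {v : ℤ → Fin M} {m : ℕ}
    (hv : MinRepetitions v m) (k : ℤ) :
    ∃ r : ℕ, r ≤ m ∧ ConstBefore v m (k - r) ∧ ∀ i : ℕ, i ≤ r → v (k - i) = v k := by
  by_cases h : ConstBefore v m k
  · exact ⟨0, Nat.zero_le _, by simpa using h, fun i hi => by simp [Nat.le_zero.1 hi]⟩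
  · obtain ⟨j, hj, hjm, hsw, hc⟩ := exists_switch_of_not_constBefore h
    refine ⟨j, hjm.le, hv.constBefore_of_switch hsw, ?_⟩
    have h1 := hv (k - j - 1) (by rwa [sub_add_cancel]) (j + 1) (by omega) (by omega)
    rw [sub_add_cancel, hc j hj le_rfl] at h1
    have h2 : v k = v (k - 1) := by
      rw [← h1]
      congr 1
      push_cast
      ring
    intro i hi
    rcases Nat.eq_zero_or_pos i with rfl | hpos
    · simp
    · rw [hc i hpos hi, h2]

/-- A time preceded by `m` steps of constant input is reached from an earlier such time through
between `m` and `2 * m` steps of constant input. -/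
theorem MinRepetitions.exists_constBefore_sub {M : ℕ} {v : ℤ → Fin M} {m : ℕ}
    (hv : MinRepetitions v m) (hm : 1 ≤ m) {k : ℤ} (hk : ConstBefore v m k) :
    ∃ t : ℕ, m ≤ t ∧ t ≤ 2 * m ∧ ConstBefore v m (k - t) ∧ ConstBefore v t k := by
  obtain ⟨r, hr, hcr, hconst⟩ := hv.exists_constBefore (k - m)
  refine ⟨m + r, by omega, by omega, ?_, fun i hi hit => ?_⟩
  · convert hcr using 1
    push_cast
    ring
  · rcases Nat.lt_or_ge m i with hlt | hle
    · have h1 := hconst (i - m) (by omega)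
      rw [hk m hm le_rfl] at h1
      rw [← h1]
      congr 1
      push_cast [hlt.le]
      ring
    · exact hk i hi hle

section PullbackAttraction

variable {d M : ℕ} {f : Fin M → EuclideanSpace ℝ (Fin d) → EuclideanSpace ℝ (Fin d)}
  {L : Fin M → ℕ} {xfix : Fin M → ℕ → EuclideanSpace ℝ (Fin d)} {P : Fin M → ℕ → Fin M → ℕ}
  {m : ℕ} {ε δ : ℝ} {v : ℤ → Fin M} {A : ℤ → ℕ}

/-- `A` is an entire attractor sequence for the input `v`. -/
structure IsAttractorSequence (L : Fin M → ℕ) (P : Fin M → ℕ → Fin M → ℕ) (v : ℤ → Fin M)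
    (A : ℤ → ℕ) : Prop where
  lt : ∀ k, A k < L (v k)
  succ : ∀ k, A (k + 1) = P (v k) (A k) (v (k + 1))

/-- Uniform estimates near the attractors: after `m` steps of constant input, `ε`-balls around
attractors are contracted by `1 / 2` into the `ε`-ball around the next attractor, and `δ`-balls
never leave the `ε`-ball as long as the input agrees with the attractor. -/
structure ContractsBalls (f : Fin M → EuclideanSpace ℝ (Fin d) → EuclideanSpace ℝ (Fin d))
    (L : Fin M → ℕ) (xfix : Fin M → ℕ → EuclideanSpace ℝ (Fin d)) (P : Fin M → ℕ → Fin M → ℕ)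
    (m : ℕ) (ε δ : ℝ) : Prop where
  dist_le : ∀ i k, ∀ j < L i, ∀ n, m ≤ n → ∀ y ∈ Metric.closedBall (xfix i j) ε,
    ∀ z ∈ Metric.closedBall (xfix i j) ε, dist ((f k)^[n] y) ((f k)^[n] z) ≤ dist y z / 2
  mapsTo : ∀ i k, ∀ j < L i, ∀ n, m ≤ n →
    Set.MapsTo (f k)^[n] (Metric.closedBall (xfix i j) ε) (Metric.closedBall (xfix k (P i j k)) ε)
  mapsTo_self : ∀ i, ∀ j < L i, ∀ n,
    Set.MapsTo (f i)^[n] (Metric.closedBall (xfix i j) δ) (Metric.closedBall (xfix i j) ε)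
  tendsto : ∀ i k, ∀ j < L i, ∀ y ∈ Metric.closedBall (xfix i j) ε,
    Tendsto (fun n => (f k)^[n] y) atTop (𝓝 (xfix k (P i j k)))

theorem IsAttractorSequence.eq_of_eq (hA : IsAttractorSequence L P v A)
    (hP : ∀ i, ∀ j < L i, P i j i = j) {k : ℤ} (h : v k = v (k + 1)) : A (k + 1) = A k := by
  rw [hA.succ, ← h, hP _ _ (hA.lt k)]

theorem IsAttractorSequence.eq_sub_of_const (hA : IsAttractorSequence L P v A)
    (hP : ∀ i, ∀ j < L i, P i j i = j) {k : ℤ} {r : ℕ} (h : ∀ i ≤ r, v (k - i) = v k) :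
    ∀ i ≤ r, A (k - i) = A k := by
  intro i hi
  induction i with
  | zero => simp
  | succ i ih =>
    have hk : k - (i + 1 : ℕ) + 1 = k - i := by
      push_cast
      ring
    rw [← ih (by omega), ← hk]
    refine (hA.eq_of_eq hP ?_).symm
    rw [hk, h _ hi, h i (by omega)]

theorem IsAttractorSequence.eq_of_constBefore (hA : IsAttractorSequence L P v A)
    (hP : ∀ i, ∀ j < L i, P i j i = j) {k : ℤ} {t : ℕ} (h : ConstBefore v t k) {i : ℕ}
    (hi : 1 ≤ i) (hit : i ≤ t) : A (k - i) = A (k - 1) := by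
  have hcast : ∀ l : ℕ, k - 1 - l = k - (l + 1 : ℕ) := fun l => by
    push_cast
    ring
  have h1 := hA.eq_sub_of_const hP (k := k - 1) (r := t - 1)
    (fun l hl => by rw [hcast]; exact h (l + 1) (by omega) (by omega)) (i - 1) (by omega)
  rwa [hcast, Nat.sub_add_cancel hi] at h1

/-- Long constant stretches contract the ball around the previous attractor into the ball around
the current one. -/
theorem ContractsBalls.pullComp_constBefore (hC : ContractsBalls f L xfix P m ε δ)
    (hA : IsAttractorSequence L P v A) (hP : ∀ i, ∀ j < L i, P i j i = j) {k : ℤ} {t : ℕ}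
    (ht : 1 ≤ t) (hmt : m ≤ t) (h : ConstBefore v t k) :
    Set.MapsTo (pullComp f v k t)
      (Metric.closedBall (xfix (v (k - t - 1)) (A (k - t - 1))) ε)
      (Metric.closedBall (xfix (v (k - 1)) (A (k - 1))) ε) ∧
    ∀ y ∈ Metric.closedBall (xfix (v (k - t - 1)) (A (k - t - 1))) ε,
      ∀ z ∈ Metric.closedBall (xfix (v (k - t - 1)) (A (k - t - 1))) ε,
        dist (pullComp f v k t y) (pullComp f v k t z) ≤ dist y z / 2 := by
  rw [pullComp_eq_iterate f v k _ t h]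
  have h1 := hA.succ (k - t - 1)
  rw [sub_add_cancel, hA.eq_of_constBefore hP h ht le_rfl, h t ht le_rfl] at h1
  rw [h1]
  exact ⟨hC.mapsTo _ _ _ (hA.lt _) t hmt, hC.dist_le _ _ _ (hA.lt _) t hmt⟩

/-- The `δ`-ball around the attractor at any earlier time is pulled into the `ε`-ball. -/
theorem ContractsBalls.mapsTo_pullComp (hC : ContractsBalls f L xfix P m ε δ) (hm : 1 ≤ m)
    (hv : MinRepetitions v m) (hA : IsAttractorSequence L P v A)
    (hP : ∀ i, ∀ j < L i, P i j i = j) {n : ℕ} (hn : 1 ≤ n) {k : ℤ} (hk : ConstBefore v m k) :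
    Set.MapsTo (pullComp f v k n) (Metric.closedBall (xfix (v (k - n)) (A (k - n))) δ)
      (Metric.closedBall (xfix (v (k - 1)) (A (k - 1))) ε) := by
  induction n using Nat.strong_induction_on generalizing k with
  | _ n ih =>
    obtain ⟨t, hmt, -, hkt, ht⟩ := hv.exists_constBefore_sub hm hk
    rcases Nat.lt_or_ge t n with hlt | hle
    · obtain ⟨b, rfl⟩ := Nat.exists_eq_add_of_le hlt.le
      rw [pullComp_add, Nat.cast_add, ← sub_sub]
      exact (hC.pullComp_constBefore hA hP (hm.trans hmt) hmt ht).1.comp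
        (ih b (by omega) (by omega) hkt)
    · rw [pullComp_eq_iterate f v k (v (k - 1)) n fun i hi hin => ht i hi (hin.trans hle),
        hA.eq_of_constBefore hP ht hn hle, ht n hn hle]
      exact hC.mapsTo_self _ _ (by simpa [ht n hn hle] using hA.lt (k - 1)) n

/-- Pullbacks of `δ`-balls from remote times are exponentially close. -/
theorem ContractsBalls.dist_pullComp_le (hC : ContractsBalls f L xfix P m ε δ) (hm : 1 ≤ m)
    (hv : MinRepetitions v m) (hA : IsAttractorSequence L P v A)
    (hP : ∀ i, ∀ j < L i, P i j i = j) {k : ℤ} (hk : ConstBefore v m k) {j n n' : ℕ}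
    (hn : 2 * m * j < n) (hn' : 2 * m * j < n') {y z : EuclideanSpace ℝ (Fin d)}
    (hy : y ∈ Metric.closedBall (xfix (v (k - n)) (A (k - n))) δ)
    (hz : z ∈ Metric.closedBall (xfix (v (k - n')) (A (k - n'))) δ) :
    dist (pullComp f v k n y) (pullComp f v k n' z) ≤ 2 * ε * (1 / 2) ^ j := by
  induction j generalizing k n n' with
  | zero =>
    have h1 := hC.mapsTo_pullComp hm hv hA hP (by omega) hk hy
    have h2 := hC.mapsTo_pullComp hm hv hA hP (by omega) hk hz
    have h3 := dist_triangle_right (pullComp f v k n y) (pullComp f v k n' z)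
      (xfix (v (k - 1)) (A (k - 1)))
    rw [Metric.mem_closedBall] at h1 h2
    linarith
  | succ j ih =>
    obtain ⟨t, hmt, htm, hkt, ht⟩ := hv.exists_constBefore_sub hm hk
    rw [Nat.mul_succ] at hn hn'
    obtain ⟨b, rfl⟩ := Nat.exists_eq_add_of_le (show t ≤ n by omega)
    obtain ⟨b', rfl⟩ := Nat.exists_eq_add_of_le (show t ≤ n' by omega)
    rw [Nat.cast_add, ← sub_sub] at hy hz
    have h1 := hC.mapsTo_pullComp hm hv hA hP (by omega) hkt hy
    have h2 := hC.mapsTo_pullComp hm hv hA hP (by omega) hkt hz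
    have h3 := (hC.pullComp_constBefore hA hP (hm.trans hmt) hmt ht).2 _ h1 _ h2
    have h4 := ih hkt (by omega) (by omega) hy hz
    rw [pullComp_add, pullComp_add, pow_succ]
    simp only [Function.comp_apply]
    linarith

/-- Pullbacks to time `k` of the `δ`-balls around the attractor sequence shrink to `p`. -/
def PullbackAttracts (f : Fin M → EuclideanSpace ℝ (Fin d) → EuclideanSpace ℝ (Fin d))
    (xfix : Fin M → ℕ → EuclideanSpace ℝ (Fin d)) (δ : ℝ) (v : ℤ → Fin M) (A : ℤ → ℕ) (k : ℤ)
    (p : EuclideanSpace ℝ (Fin d)) : Prop :=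
  ∀ U ∈ 𝓝 p, ∀ᶠ n : ℕ in atTop,
    Set.MapsTo (pullComp f v k n) (Metric.closedBall (xfix (v (k - n)) (A (k - n))) δ) U

theorem PullbackAttracts.tendsto {k : ℤ} {p : EuclideanSpace ℝ (Fin d)}
    (h : PullbackAttracts f xfix δ v A k p) (hδ : 0 ≤ δ) :
    Tendsto (fun n : ℕ => pullComp f v k n (xfix (v (k - n)) (A (k - n)))) atTop (𝓝 p) :=
  fun U hU => (h U hU).mono fun _ hn => hn (Metric.mem_closedBall_self hδ)

theorem PullbackAttracts.tendsto_sSup {k : ℤ} {p : EuclideanSpace ℝ (Fin d)}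
    (h : PullbackAttracts f xfix δ v A k p) :
    Tendsto (fun n : ℕ => sSup ((fun y => ‖pullComp f v k n y - p‖) ''
      Metric.closedBall (xfix (v (k - n)) (A (k - n))) δ)) atTop (𝓝 0) := by
  rw [Metric.tendsto_nhds]
  intro η hη
  filter_upwards [h _ (Metric.closedBall_mem_nhds p (half_pos hη))] with n hn
  rw [Real.dist_0_eq_abs, abs_of_nonneg]
  · refine (Real.sSup_le ?_ (half_pos hη).le).trans_lt (half_lt_self hη)
    rintro _ ⟨y, hy, rfl⟩
    simpa [dist_eq_norm] using hn hy
  · refine Real.sSup_nonneg ?_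
    rintro _ ⟨y, -, rfl⟩
    exact norm_nonneg _

/-- Pullback attraction propagates forward in time. -/
theorem PullbackAttracts.pullComp {k : ℤ} {p : EuclideanSpace ℝ (Fin d)} (r : ℕ)
    (hf : ∀ i, Continuous (f i)) (h : PullbackAttracts f xfix δ v A (k - r) p) :
    PullbackAttracts f xfix δ v A k (pullComp f v k r p) := by
  intro U hU
  have h1 := h _ ((continuous_pullComp hf v k r).continuousAt hU)
  rw [eventually_atTop] at h1 ⊢
  obtain ⟨N, hN⟩ := h1
  refine ⟨r + N, fun n hn => ?_⟩
  obtain ⟨b, rfl⟩ := Nat.exists_eq_add_of_le (show r ≤ n by omega)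
  rw [pullComp_add, Nat.cast_add, ← sub_sub]
  exact hN b (by omega)

theorem ContractsBalls.exists_pullbackAttracts_of_constBefore
    (hC : ContractsBalls f L xfix P m ε δ) (hm : 1 ≤ m) (hδ : 0 ≤ δ)
    (hv : MinRepetitions v m) (hA : IsAttractorSequence L P v A)
    (hP : ∀ i, ∀ j < L i, P i j i = j) {k : ℤ} (hk : ConstBefore v m k) :
    ∃ p, PullbackAttracts f xfix δ v A k p := by
  have hlim : Tendsto (fun j : ℕ => 2 * ε * (1 / 2 : ℝ) ^ j) atTop (𝓝 0) := by
    simpa using (tendsto_pow_atTop_nhds_zero_of_lt_one (r := (1 / 2 : ℝ)) (by norm_num)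
      (by norm_num)).const_mul (2 * ε)
  have hcauchy : CauchySeq fun n : ℕ => pullComp f v k n (xfix (v (k - n)) (A (k - n))) := by
    refine Metric.cauchySeq_iff.2 fun η hη => ?_
    obtain ⟨j, hj⟩ := (hlim.eventually_lt_const hη).exists
    refine ⟨2 * m * j + 1, fun n hn n' hn' => lt_of_le_of_lt ?_ hj⟩
    exact hC.dist_pullComp_le hm hv hA hP hk (by omega) (by omega)
      (Metric.mem_closedBall_self hδ) (Metric.mem_closedBall_self hδ)
  obtain ⟨p, hp⟩ := cauchySeq_tendsto_of_complete hcauchy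
  refine ⟨p, fun U hU => ?_⟩
  obtain ⟨η, hη, hsub⟩ := Metric.nhds_basis_closedBall.mem_iff.1 hU
  obtain ⟨j, hj⟩ := (hlim.eventually_lt_const hη).exists
  filter_upwards [eventually_gt_atTop (2 * m * j)] with n hn y hy
  refine hsub (le_of_tendsto (tendsto_const_nhds.dist hp) ?_)
  filter_upwards [eventually_gt_atTop (2 * m * j)] with n' hn'
  exact (hC.dist_pullComp_le hm hv hA hP hk hn hn' hy (Metric.mem_closedBall_self hδ)).trans hj.le

theorem ContractsBalls.exists_pullbackAttracts (hC : ContractsBalls f L xfix P m ε δ)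
    (hf : ∀ i, Continuous (f i)) (hm : 1 ≤ m) (hδ : 0 ≤ δ)
    (hv : MinRepetitions v m) (hA : IsAttractorSequence L P v A)
    (hP : ∀ i, ∀ j < L i, P i j i = j) (k : ℤ) :
    ∃ p, PullbackAttracts f xfix δ v A k p := by
  obtain ⟨r, -, hk, -⟩ := hv.exists_constBefore k
  obtain ⟨p, hp⟩ := hC.exists_pullbackAttracts_of_constBefore hm hδ hv hA hP hk
  exact ⟨_, hp.pullComp r hf⟩

theorem ContractsBalls.mem_closedBall_of_pullbackAttracts (hC : ContractsBalls f L xfix P m ε δ)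
    (hm : 1 ≤ m) (hδ : 0 ≤ δ)
    (hv : MinRepetitions v m) (hA : IsAttractorSequence L P v A)
    (hP : ∀ i, ∀ j < L i, P i j i = j) {k : ℤ} (hk : ConstBefore v m k)
    {p : EuclideanSpace ℝ (Fin d)} (hp : PullbackAttracts f xfix δ v A k p) :
    p ∈ Metric.closedBall (xfix (v (k - 1)) (A (k - 1))) ε := by
  refine Metric.isClosed_closedBall.mem_of_tendsto (hp.tendsto hδ) ?_
  filter_upwards [eventually_ge_atTop 1] with n hn
  exact hC.mapsTo_pullComp hm hv hA hP hn hk (Metric.mem_closedBall_self hδ)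

/-- A pullback attracting solution lies in the basin of the upcoming attractor. -/
theorem ContractsBalls.tendsto_iterate_of_pullbackAttracts
    (hC : ContractsBalls f L xfix P m ε δ) (hf : ∀ i, Continuous (f i))
    (hm : 1 ≤ m) (hδ : 0 ≤ δ)
    (hv : MinRepetitions v (m + 1)) (hA : IsAttractorSequence L P v A)
    (hP : ∀ i, ∀ j < L i, P i j i = j) {k : ℤ}
    {p : EuclideanSpace ℝ (Fin d)} (hp : PullbackAttracts f xfix δ v A k p) :
    Tendsto (fun n => (f (v (k + 1)))^[n] p) atTop (𝓝 (xfix (v (k + 1)) (A (k + 1)))) := by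
  have hv' : MinRepetitions v m := hv.mono (Nat.le_succ m)
  by_cases hsw : v k = v (k + 1)
  · obtain ⟨r, -, hk, hr⟩ := hv'.exists_constBefore k
    obtain ⟨q, hq⟩ := hC.exists_pullbackAttracts_of_constBefore hm hδ hv' hA hP hk
    have hqp := tendsto_nhds_unique (hp.tendsto hδ) ((hq.pullComp r hf).tendsto hδ)
    have hball := hC.mem_closedBall_of_pullbackAttracts hm hδ hv' hA hP hk hq
    rw [pullComp_eq_iterate f v k (v k) r fun i _ hi => hr i hi] at hqp
    have h1 := hA.succ (k - r - 1)
    rw [sub_add_cancel, hA.eq_sub_of_const hP hr r le_rfl, hr r le_rfl] at h1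
    rw [hA.eq_of_eq hP hsw, ← hsw, h1, hqp]
    simp only [← Function.iterate_add_apply]
    exact (tendsto_add_atTop_iff_nat r).2 (hC.tendsto _ _ _ (hA.lt _) _ hball)
  · have hc : ConstBefore v (m + 1) (k + 1) :=
      hv.constBefore_of_switch (by rwa [add_sub_cancel_right])
    have hkc : ∀ i ≤ m, v (k - i) = v k := fun i hi => by
      have h1 := hc (i + 1) (by omega) (by omega)
      rw [add_sub_cancel_right] at h1
      rw [← h1]
      congr 1
      push_cast
      ring
    have hk : ConstBefore v m k := fun i _ hi =>
      (hkc i hi).trans (by simpa using (hkc 1 hm).symm)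
    have hball := hC.mem_closedBall_of_pullbackAttracts hm hδ hv' hA hP hk hp
    have hv1 : v (k - 1) = v k := by simpa using hkc 1 hm
    have hA1 : A (k - 1) = A k := by simpa using hA.eq_sub_of_const hP hkc 1 hm
    rw [hv1, hA1] at hball
    rw [hA.succ]
    exact hC.tendsto _ _ _ (hA.lt _) _ hball

end PullbackAttraction

/-- Finitely many hyperbolically stable fixed points admit common contraction estimates. -/
theorem exists_contractsBalls {d M : ℕ}
    {f : Fin M → EuclideanSpace ℝ (Fin d) → EuclideanSpace ℝ (Fin d)}
    {L : Fin M → ℕ} {xfix : Fin M → ℕ → EuclideanSpace ℝ (Fin d)} {P : Fin M → ℕ → Fin M → ℕ}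
    (hreg : ∀ i, ContDiff ℝ 1 (f i))
    (hfixed : ∀ i, ∀ j < L i, f i (xfix i j) = xfix i j)
    (hhyp : ∀ i, ∀ j < L i, ∃ N : ℕ, 1 ≤ N ∧ ‖(fderiv ℝ (f i) (xfix i j)) ^ N‖ < 1)
    (hPlt : ∀ i k, ∀ j < L i, P i j k < L k)
    (hPtendsto : ∀ i k, ∀ j < L i,
      Tendsto (fun n => (f k)^[n] (xfix i j)) atTop (𝓝 (xfix k (P i j k)))) :
    ∃ m : ℕ, 1 ≤ m ∧ ∃ ε δ : ℝ, 0 < δ ∧ ContractsBalls f L xfix P m ε δ := by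
  have hlocal : ∀ (a : Σ i, Fin (L i)) (k : Fin M), ∃ s ∈ 𝓝 (xfix a.1 a.2),
      ∃ c : ℕ → ℝ≥0, Tendsto c atTop (𝓝 0) ∧ ∀ n, LipschitzOnWith (c n) (f k)^[n] s := by
    intro a k
    have hlt := hPlt a.1 k a.2 a.2.2
    obtain ⟨N, hN, hyp⟩ := hhyp k _ hlt
    exact exists_nhds_lipschitzOnWith_iterate_of_tendsto (hreg k) (hfixed k _ hlt) hN hyp
      (hPtendsto a.1 k a.2 a.2.2)
  choose s hs c hc hlip using hlocal
  obtain ⟨ε, hεs, hε⟩ : ∃ ε : ℝ, (∀ a k, Metric.closedBall (xfix a.1 a.2) ε ⊆ s a k) ∧ 0 < ε := by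
    have hev : ∀ᶠ ε : ℝ in 𝓝[>] 0, ∀ a k, Metric.closedBall (xfix a.1 a.2) ε ⊆ s a k := by
      refine eventually_all.2 fun a => eventually_all.2 fun k => ?_
      obtain ⟨η, hη, hsub⟩ := Metric.nhds_basis_closedBall.mem_iff.1 (hs a k)
      filter_upwards [Ioo_mem_nhdsGT hη] with ε hε
      exact (Metric.closedBall_subset_closedBall hε.2.le).trans hsub
    exact (hev.and self_mem_nhdsWithin).exists
  obtain ⟨m, hm⟩ : ∃ m : ℕ, ∀ n, m ≤ n → ∀ a k, c a k n ≤ 1 / 2 ∧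
      dist ((f k)^[n] (xfix a.1 a.2)) (xfix k (P a.1 a.2 k)) ≤ ε / 2 := by
    refine eventually_atTop.1 (eventually_all.2 fun a => eventually_all.2 fun k => ?_)
    refine ((hc a k).eventually_le_const (by norm_num)).and ?_
    exact (hPtendsto a.1 k a.2 a.2.2).eventually
      (Metric.closedBall_mem_nhds _ (half_pos hε))
  obtain ⟨δ, hδε, hδ⟩ : ∃ δ : ℝ, (∀ a : Σ i, Fin (L i), δ ≤ ε ∧ ∀ n, c a a.1 n * δ ≤ ε) ∧
      0 < δ := by
    have hev : ∀ᶠ δ : ℝ in 𝓝[>] 0, ∀ a : Σ i, Fin (L i), δ ≤ ε ∧ ∀ n, c a a.1 n * δ ≤ ε := by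
      refine eventually_all.2 fun a => ?_
      obtain ⟨C, hC⟩ := (hc a a.1).bddAbove_range
      have h0 : Tendsto (fun δ : ℝ => C * δ) (𝓝[>] 0) (𝓝 0) := by
        have h : Tendsto (fun δ : ℝ => C * δ) (𝓝 0) (𝓝 (C * 0)) := tendsto_id.const_mul _
        rw [mul_zero] at h
        exact h.mono_left nhdsWithin_le_nhds
      filter_upwards [Ioo_mem_nhdsGT hε, h0.eventually_le_const hε] with δ hδ hCδ
      refine ⟨hδ.2.le, fun n => le_trans ?_ hCδ⟩
      exact mul_le_mul_of_nonneg_right (NNReal.coe_le_coe.2 (hC ⟨n, rfl⟩)) hδ.1.le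
    exact (hev.and self_mem_nhdsWithin).exists
  have hdist : ∀ (a : Σ i, Fin (L i)) k n, m ≤ n → ∀ y ∈ Metric.closedBall (xfix a.1 a.2) ε,
      ∀ z ∈ Metric.closedBall (xfix a.1 a.2) ε,
        dist ((f k)^[n] y) ((f k)^[n] z) ≤ dist y z / 2 := by
    intro a k n hn y hy z hz
    have h1 := (hlip a k n).dist_le_mul y (hεs a k hy) z (hεs a k hz)
    have h2 : (c a k n : ℝ) ≤ 1 / 2 := by exact_mod_cast (hm n hn a k).1
    have h3 := mul_le_mul_of_nonneg_right h2 (dist_nonneg (x := y) (y := z))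
    linarith
  refine ⟨max m 1, le_max_right _ _, ε, δ, hδ, ⟨?_, ?_, ?_, ?_⟩⟩
  · exact fun i k j hj n hn => hdist ⟨i, j, hj⟩ k n ((le_max_left _ _).trans hn)
  · intro i k j hj n hn y hy
    have hn' : m ≤ n := (le_max_left _ _).trans hn
    have h1 := hdist ⟨i, j, hj⟩ k n hn' y hy _ (Metric.mem_closedBall_self hε.le)
    have h2 := (hm n hn' ⟨i, j, hj⟩ k).2
    have h3 := dist_triangle ((f k)^[n] y) ((f k)^[n] (xfix i j)) (xfix k (P i j k))
    rw [Metric.mem_closedBall] at hy ⊢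
    dsimp only at h1 h2
    linarith
  · intro i j hj n y hy
    obtain ⟨hle, hbd⟩ := hδε ⟨i, j, hj⟩
    have hsub := hεs ⟨i, j, hj⟩ i
    have h1 := (hlip ⟨i, j, hj⟩ i n).dist_le_mul y
      (hsub (Metric.closedBall_subset_closedBall hle hy)) _ (hsub (Metric.mem_closedBall_self hε.le))
    rw [Function.iterate_fixed (hfixed i j hj)] at h1
    exact h1.trans ((mul_le_mul_of_nonneg_left hy NNReal.zero_le_coe).trans (hbd n))
  · intro i k j hj y hy
    have hsub := hεs ⟨i, j, hj⟩ k
    have h0 : Tendsto (fun n => (c ⟨i, j, hj⟩ k n : ℝ) * dist (xfix i j) y) atTop (𝓝 0) := by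
      simpa using (NNReal.tendsto_coe.2 (hc ⟨i, j, hj⟩ k)).mul_const (dist (xfix i j) y)
    refine (hPtendsto i k j hj).congr_dist (squeeze_zero (fun _ => dist_nonneg) (fun n => ?_) h0)
    exact (hlip ⟨i, j, hj⟩ k n).dist_le_mul _ (hsub (Metric.mem_closedBall_self hε.le)) y (hsub hy)

/-- under Assumption 1 (each map `f i` is C¹ with hyperbolically stable fixed
points `xfix i 0, …, xfix i (L i − 1)` whose basins are compatible via the transition map
`P`), there exist `m_min ≥ 1` and `ε > 0` such that for every input `v` with minimum
repetitions `≥ m_min` and every entire attractor sequence `A` for `v`, there is an entire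
solution `x` with `x k ∈ B_{v(k+1)}^{A(k+1)}` which pullback attracts the `ε`-ball around
its attractor sequence. -/
theorem exists_pullback_attracting_entire_solution_of_attractor_sequence
    {d M : ℕ} (X : Set (EuclideanSpace ℝ (Fin d)))
    (hXne : X.Nonempty) (hXcomp : IsCompact X)
    (f : Fin M → EuclideanSpace ℝ (Fin d) → EuclideanSpace ℝ (Fin d))
    (hreg : ∀ i, ContDiff ℝ 1 (f i)) (hfmap : ∀ i, Set.MapsTo (f i) X X)
    (L : Fin M → ℕ) (xfix : Fin M → ℕ → EuclideanSpace ℝ (Fin d))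
    (hfixX : ∀ i, ∀ j < L i, xfix i j ∈ X)
    (hfixed : ∀ i, ∀ j < L i, f i (xfix i j) = xfix i j)
    (hdistinct : ∀ i, ∀ j < L i, ∀ j' < L i, xfix i j = xfix i j' → j = j')
    (hhyp : ∀ i, ∀ j < L i, ∃ N : ℕ, 1 ≤ N ∧ ‖(fderiv ℝ (f i) (xfix i j)) ^ N‖ < 1)
    (P : Fin M → ℕ → Fin M → ℕ)
    (hPid : ∀ i, ∀ j < L i, P i j i = j)
    (hPlt : ∀ i k, ∀ j < L i, P i j k < L k)
    (hPbasin : ∀ i k, ∀ j < L i, xfix i j ∈ basinOf X (f k) (xfix k (P i j k))) :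
    ∃ m_min : ℕ, 1 ≤ m_min ∧ ∃ ε : ℝ, 0 < ε ∧
      ∀ v : ℤ → Fin M, MinRepetitions v m_min →
      ∀ A : ℤ → ℕ, (∀ k : ℤ, A k < L (v k)) →
        (∀ k : ℤ, A (k + 1) = P (v k) (A k) (v (k + 1))) →
        ∃ x : ℤ → EuclideanSpace ℝ (Fin d),
          (∀ k : ℤ, x k ∈ X) ∧
          (∀ k : ℤ, x (k + 1) = f (v k) (x k)) ∧
          (∀ k : ℤ, x k ∈ basinOf X (f (v (k + 1))) (xfix (v (k + 1)) (A (k + 1)))) ∧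
          (∀ k : ℤ, Filter.Tendsto
            (fun n : ℕ => sSup ((fun y => ‖pullComp f v k n y - x k‖) ''
              Metric.closedBall (xfix (v (k - n)) (A (k - n))) ε))
            Filter.atTop (nhds 0)) := by
  obtain ⟨m, hm, ε, δ, hδ, hC⟩ := exists_contractsBalls hreg hfixed hhyp hPlt
    fun i k j hj => (hPbasin i k j hj).2
  refine ⟨m + 1, by omega, δ, hδ, fun v hv A hAlt hAsucc => ?_⟩
  have hA : IsAttractorSequence L P v A := ⟨hAlt, hAsucc⟩
  have hf : ∀ i, Continuous (f i) := fun i => (hreg i).continuous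
  choose x hx using fun k =>
    hC.exists_pullbackAttracts hf hm hδ.le (hv.mono (Nat.le_succ m)) hA hPid k
  have hxX : ∀ k, x k ∈ X := fun k =>
    hXcomp.isClosed.mem_of_tendsto ((hx k).tendsto hδ.le)
      (Eventually.of_forall fun n => mapsTo_pullComp hfmap v k n (hfixX _ _ (hAlt _)))
  refine ⟨x, hxX, fun k => ?_, fun k => ⟨hxX k, ?_⟩, fun k => (hx k).tendsto_sSup⟩
  · have h : PullbackAttracts f xfix δ v A (k + 1 - (1 : ℕ)) (x k) := by simpa using hx k
    have h1 := tendsto_nhds_unique ((hx (k + 1)).tendsto hδ.le) ((h.pullComp 1 hf).tendsto hδ.le)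
    rwa [pullComp_eq_iterate f v (k + 1) (v k) 1 fun i hi hi1 => by
      simp [show i = 1 by omega]] at h1
  · exact hC.tendsto_iterate_of_pullbackAttracts hf hm hδ.le hv hA hPid (hx k)
end

section
/- If f : ℝᵈ → ℝᵈ is continuously differentiable and the set of points where the derivative Df(x) is not invertible has Lebesgue measure zero, then the preimage under f of any set of Lebesgue measure zero has Lebesgue measure zero. -/
/-- Near a point where a `C¹` map has an invertible derivative, preimages of null sets are null. -/
theorem ContDiffAt.exists_mem_nhds_measure_inter_preimage_eq_zero
    {E : Type*} [NormedAddCommGroup E] [NormedSpace ℝ E] [FiniteDimensional ℝ E]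
    [MeasurableSpace E] [BorelSpace E] (μ : MeasureTheory.Measure E) [μ.IsAddHaarMeasure]
    {f : E → E} {f' : E ≃L[ℝ] E} {a : E} (hf : ContDiffAt ℝ 1 f a)
    (hf' : HasFDerivAt f (f' : E →L[ℝ] E) a) {S : Set E} (hS : μ S = 0) :
    ∃ u ∈ nhds a, μ (u ∩ f ⁻¹' S) = 0 := by
  have hstrict : HasStrictFDerivAt f (f' : E →L[ℝ] E) a :=
    hf.hasStrictFDerivAt' hf' one_ne_zero
  set g : E → E := hf.localInverse hf' one_ne_zero
  have hg : ContDiffAt ℝ 1 g (f a) := hf.to_localInverse hf' one_ne_zero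
  have hinv : ∀ᶠ x in nhds a, g (f x) = x := hstrict.eventually_left_inverse
  have hdiff : ∀ᶠ y in nhds (f a), DifferentiableAt ℝ g y :=
    (hg.eventually (by simp)).mono fun y hy => hy.differentiableAt one_ne_zero
  refine ⟨_, hinv.and (hf.continuousAt.eventually hdiff), ?_⟩
  refine MeasureTheory.measure_mono_null (t := g '' (S ∩ {y | DifferentiableAt ℝ g y}))
    (fun x hx => ⟨f x, ⟨hx.2, hx.1.2⟩, hx.1.1⟩) ?_
  exact MeasureTheory.addHaar_image_eq_zero_of_differentiableOn_of_addHaar_eq_zero μ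
    (fun y hy => hy.2.differentiableWithinAt)
    (MeasureTheory.measure_mono_null Set.inter_subset_left hS)


/-- if `f : ℝᵈ → ℝᵈ` is C¹ and the set of points where `Df(x)` is not
invertible has Lebesgue measure zero, then the preimage under `f` of any Lebesgue null
set is Lebesgue null. -/
theorem preimage_null_of_null_of_ae_local_diffeomorphism
    {d : ℕ} (f : EuclideanSpace ℝ (Fin d) → EuclideanSpace ℝ (Fin d))
    (hf : ContDiff ℝ 1 f)
    (hcrit : MeasureTheory.volume
      {x : EuclideanSpace ℝ (Fin d) | ¬ Function.Bijective (fderiv ℝ f x)} = 0) :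
    ∀ S : Set (EuclideanSpace ℝ (Fin d)), MeasureTheory.volume S = 0 →
      MeasureTheory.volume (f ⁻¹' S) = 0 := by
  intro S hS
  refine MeasureTheory.measure_mono_null
    (t := {x | ¬ Function.Bijective (fderiv ℝ f x)} ∪
      (f ⁻¹' S ∩ {x | Function.Bijective (fderiv ℝ f x)}))
    (fun x hx => (em (Function.Bijective (fderiv ℝ f x))).symm.imp id fun h => ⟨hx, h⟩) ?_
  refine MeasureTheory.measure_union_null hcrit ?_
  refine MeasureTheory.measure_null_of_locally_null _ fun a ha => ?_
  let f' : EuclideanSpace ℝ (Fin d) ≃L[ℝ] EuclideanSpace ℝ (Fin d) :=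
    (LinearEquiv.ofBijective (fderiv ℝ f a).toLinearMap ha.2).toContinuousLinearEquiv
  have hf' : HasFDerivAt f (f' : EuclideanSpace ℝ (Fin d) →L[ℝ] EuclideanSpace ℝ (Fin d)) a :=
    (hf.differentiable one_ne_zero a).hasFDerivAt
  obtain ⟨u, hu, hu0⟩ :=
    hf.contDiffAt.exists_mem_nhds_measure_inter_preimage_eq_zero MeasureTheory.volume hf' hS
  refine ⟨_, inter_mem_nhdsWithin _ hu, MeasureTheory.measure_mono_null ?_ hu0⟩
  exact fun x hx => ⟨hx.2, hx.1.1⟩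
end

section
/- There exists a unique sequence x : ℤ → ℝᵈ with x(k) ∈ K_k and g_k(x(k)) = x(k+1) for all k ∈ ℤ. Moreover this entire solution is uniformly pullback attracting: for every k ∈ ℤ and every n ≥ 1, sup_{y ∈ K_{k−n}} |(g_{k−1} ∘ g_{k−2} ∘ ⋯ ∘ g_{k−n})(y) − x(k)| ≤ ρⁿ D, which tends to 0 as n → ∞. -/
/-- The composition `g_{k-1} ∘ g_{k-2} ∘ ⋯ ∘ g_{k-n}` of the nonautonomous chain of maps,
over `n` steps ending at time `k`. -/
def chainComp {d : ℕ}
    (g : ℤ → EuclideanSpace ℝ (Fin d) → EuclideanSpace ℝ (Fin d)) (k : ℤ) :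
    ℕ → (EuclideanSpace ℝ (Fin d) → EuclideanSpace ℝ (Fin d))
  | 0 => id
  | (n + 1) => chainComp g k n ∘ g (k - (n + 1))

section ChainComp

variable {d : ℕ} {ρ : ℝ} {K : ℤ → Set (EuclideanSpace ℝ (Fin d))}
  {g : ℤ → EuclideanSpace ℝ (Fin d) → EuclideanSpace ℝ (Fin d)}

theorem chainComp_succ_apply (k : ℤ) (n : ℕ) (y : EuclideanSpace ℝ (Fin d)) :
    chainComp g k (n + 1) y = chainComp g k n (g (k - (n + 1)) y) := rfl

theorem chainComp_add_one_succ_apply (k : ℤ) (n : ℕ) (y : EuclideanSpace ℝ (Fin d)) :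
    chainComp g (k + 1) (n + 1) y = g k (chainComp g k n y) := by
  induction n generalizing y with
  | zero => simp [chainComp]
  | succ n ih =>
    rw [chainComp_succ_apply, ih, chainComp_succ_apply k n, Nat.cast_succ,
      add_sub_add_right_eq_sub]

theorem mapsTo_sub_succ (hg : ∀ k, Set.MapsTo (g k) (K k) (K (k + 1))) (k : ℤ) (n : ℕ) :
    Set.MapsTo (g (k - (n + 1))) (K (k - (n + 1 : ℕ))) (K (k - n)) := by
  have h := hg (k - (n + 1))
  rw [show k - ((n : ℤ) + 1) + 1 = k - n by ring] at h
  exact_mod_cast h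

theorem mapsTo_chainComp (hg : ∀ k, Set.MapsTo (g k) (K k) (K (k + 1))) (k : ℤ) (n : ℕ) :
    Set.MapsTo (chainComp g k n) (K (k - n)) (K k) := by
  induction n with
  | zero => simp [chainComp, Set.mapsTo_id]
  | succ n ih => exact ih.comp (mapsTo_sub_succ hg k n)

theorem norm_chainComp_sub_le (hρ : 0 ≤ ρ) (hg : ∀ k, Set.MapsTo (g k) (K k) (K (k + 1)))
    (hlip : ∀ k, ∀ y ∈ K k, ∀ z ∈ K k, ‖g k y - g k z‖ ≤ ρ * ‖y - z‖) (k : ℤ) (n : ℕ)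
    {y z : EuclideanSpace ℝ (Fin d)} (hy : y ∈ K (k - n)) (hz : z ∈ K (k - n)) :
    ‖chainComp g k n y - chainComp g k n z‖ ≤ ρ ^ n * ‖y - z‖ := by
  induction n generalizing y z with
  | zero => simp [chainComp]
  | succ n ih =>
    have hstep : ‖g (k - (n + 1)) y - g (k - (n + 1)) z‖ ≤ ρ * ‖y - z‖ :=
      hlip _ y (by exact_mod_cast hy) z (by exact_mod_cast hz)
    calc ‖chainComp g k (n + 1) y - chainComp g k (n + 1) z‖
        ≤ ρ ^ n * ‖g (k - (n + 1)) y - g (k - (n + 1)) z‖ :=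
          ih (mapsTo_sub_succ hg k n hy) (mapsTo_sub_succ hg k n hz)
      _ ≤ ρ ^ n * (ρ * ‖y - z‖) := by gcongr
      _ = ρ ^ (n + 1) * ‖y - z‖ := by ring

theorem chainComp_entire_solution {x : ℤ → EuclideanSpace ℝ (Fin d)}
    (hx : ∀ k, g k (x k) = x (k + 1)) (k : ℤ) (n : ℕ) :
    chainComp g k n (x (k - n)) = x k := by
  induction n with
  | zero => simp [chainComp]
  | succ n ih =>
    rw [chainComp_succ_apply, Nat.cast_succ, hx,
      show k - ((n : ℤ) + 1) + 1 = k - n by ring, ih]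

theorem exists_entire_solution {D : ℝ} (hρ : 0 ≤ ρ) (hρ1 : ρ < 1)
    (hne : ∀ k, (K k).Nonempty) (hclosed : ∀ k, IsClosed (K k))
    (hdiam : ∀ k, ∀ y ∈ K k, ∀ z ∈ K k, ‖y - z‖ ≤ D)
    (hg : ∀ k, Set.MapsTo (g k) (K k) (K (k + 1)))
    (hlip : ∀ k, ∀ y ∈ K k, ∀ z ∈ K k, ‖g k y - g k z‖ ≤ ρ * ‖y - z‖) :
    ∃ x : ℤ → EuclideanSpace ℝ (Fin d),
      (∀ k, x k ∈ K k) ∧ ∀ k, g k (x k) = x (k + 1) := by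
  choose p hp using hne
  let u (k : ℤ) (n : ℕ) := chainComp g k n (p (k - n))
  have hu (k : ℤ) (n : ℕ) : u k n ∈ K k := mapsTo_chainComp hg k n (hp _)
  have hcauchy (k : ℤ) : CauchySeq (u k) := by
    refine cauchySeq_of_le_geometric ρ D hρ1 fun n => ?_
    have hq := mapsTo_sub_succ hg k n (hp (k - (n + 1 : ℕ)))
    calc dist (u k n) (u k (n + 1))
        ≤ ρ ^ n * ‖p (k - n) - g (k - (n + 1)) (p (k - (n + 1 : ℕ)))‖ := by
          rw [dist_eq_norm]
          exact norm_chainComp_sub_le hρ hg hlip k n (hp _) hq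
      _ ≤ ρ ^ n * D := by
          gcongr
          exact hdiam _ _ (hp _) _ hq
      _ = D * ρ ^ n := mul_comm _ _
  choose x hx using fun k => cauchySeq_tendsto_of_complete (hcauchy k)
  have hxK (k : ℤ) : x k ∈ K k :=
    (hclosed k).mem_of_tendsto (hx k) (Filter.Eventually.of_forall (hu k))
  refine ⟨x, hxK, fun k => ?_⟩
  have hgu : Filter.Tendsto (fun n => g k (u k n)) Filter.atTop (nhds (g k (x k))) := by
    rw [tendsto_iff_norm_sub_tendsto_zero]
    refine squeeze_zero (fun _ => norm_nonneg _) (fun n => hlip k _ (hu k n) _ (hxK k)) ?_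
    simpa using (tendsto_iff_norm_sub_tendsto_zero.mp (hx k)).const_mul ρ
  refine tendsto_nhds_unique hgu
    (((hx (k + 1)).comp (Filter.tendsto_add_atTop_nat 1)).congr fun n => ?_)
  change chainComp g (k + 1) (n + 1) (p (k + 1 - (n + 1 : ℕ))) = g k (chainComp g k n (p (k - n)))
  rw [chainComp_add_one_succ_apply]
  congr 3
  push_cast
  ring

end ChainComp

/-- for a chain of nonempty compact sets `K k` of diameter at most `D`,
mapped to each other by `ρ`-contractions `g k` (`ρ ∈ (0,1)`), there is a unique entire
solution `x` with `x k ∈ K k` and `g k (x k) = x (k+1)`; it is uniformly pullback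
attracting, with `sup_{y ∈ K (k-n)} ‖(g_{k-1} ∘ ⋯ ∘ g_{k-n}) y − x k‖ ≤ ρⁿ D → 0`. -/
theorem chain_of_contractions_unique_pullback_attracting_entire_solution
    {d : ℕ} (ρ D : ℝ) (hρ0 : 0 < ρ) (hρ1 : ρ < 1) (hD : 0 < D)
    (K : ℤ → Set (EuclideanSpace ℝ (Fin d)))
    (hKne : ∀ k : ℤ, (K k).Nonempty) (hKcomp : ∀ k : ℤ, IsCompact (K k))
    (hKdiam : ∀ k : ℤ, Metric.diam (K k) ≤ D)
    (g : ℤ → EuclideanSpace ℝ (Fin d) → EuclideanSpace ℝ (Fin d))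
    (hgmap : ∀ k : ℤ, Set.MapsTo (g k) (K k) (K (k + 1)))
    (hglip : ∀ k : ℤ, ∀ y ∈ K k, ∀ z ∈ K k, ‖g k y - g k z‖ ≤ ρ * ‖y - z‖) :
    ∃ x : ℤ → EuclideanSpace ℝ (Fin d),
      (∀ k : ℤ, x k ∈ K k) ∧ (∀ k : ℤ, g k (x k) = x (k + 1)) ∧
      (∀ y : ℤ → EuclideanSpace ℝ (Fin d),
        (∀ k : ℤ, y k ∈ K k) → (∀ k : ℤ, g k (y k) = y (k + 1)) → y = x) ∧
      (∀ k : ℤ, ∀ n : ℕ, 1 ≤ n → ∀ y ∈ K (k - n),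
        ‖chainComp g k n y - x k‖ ≤ ρ ^ n * D) ∧
      Filter.Tendsto (fun n : ℕ => ρ ^ n * D) Filter.atTop (nhds 0) := by
  have hdiam (k : ℤ) : ∀ y ∈ K k, ∀ z ∈ K k, ‖y - z‖ ≤ D := fun y hy z hz => by
    rw [← dist_eq_norm]
    exact (Metric.dist_le_diam_of_mem (hKcomp k).isBounded hy hz).trans (hKdiam k)
  obtain ⟨x, hxK, hx⟩ := exists_entire_solution hρ0.le hρ1 hKne
    (fun k => (hKcomp k).isClosed) hdiam hgmap hglip
  have hattr (k : ℤ) (n : ℕ) : ∀ y ∈ K (k - n), ‖chainComp g k n y - x k‖ ≤ ρ ^ n * D :=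
    fun y hy => by
      rw [← chainComp_entire_solution hx k n]
      refine (norm_chainComp_sub_le hρ0.le hgmap hglip k n hy (hxK _)).trans ?_
      gcongr
      exact hdiam _ y hy _ (hxK _)
  have hlim : Filter.Tendsto (fun n : ℕ => ρ ^ n * D) Filter.atTop (nhds 0) := by
    simpa using (tendsto_pow_atTop_nhds_zero_of_lt_one hρ0.le hρ1).mul_const D
  refine ⟨x, hxK, hx, fun y hyK hy => funext fun k => ?_, fun k n _ => hattr k n, hlim⟩
  have hle : ‖y k - x k‖ ≤ 0 := ge_of_tendsto' hlim fun n => by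
    simpa only [chainComp_entire_solution hy] using hattr k n _ (hyK (k - n))
  exact sub_eq_zero.mp (norm_le_zero_iff.mp hle)
end

section
/- For the map F : ℝ → ℝ defined by F(x) = x + x² sin(π/x) for x ≠ 0 and F(0) = 0: (a) the fixed points of F are exactly 0 and the points 1/n for nonzero integers n; (b) F is differentiable on ℝ with F'(0) = 1 and F'(1/n) = 1 − (−1)ⁿ π for every nonzero integer n; consequently |F'(1/n)| > 1 for every nonzero integer n, so F has infinitely many hyperbolic linearly unstable fixed points accumulating at the non-hyperbolic fixed point 0. -/
/-- The map `F(x) = x + x² sin(π/x)` for `x ≠ 0`, `F(0) = 0`. -/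
noncomputable def Fdiabolic : ℝ → ℝ :=
  fun x => if x = 0 then 0 else x + x ^ 2 * Real.sin (Real.pi / x)

theorem Fdiabolic_zero : Fdiabolic 0 = 0 := by simp [Fdiabolic]

theorem Fdiabolic_of_ne_zero {x : ℝ} (hx : x ≠ 0) :
    Fdiabolic x = x + x ^ 2 * Real.sin (Real.pi / x) := by simp [Fdiabolic, hx]

theorem Fdiabolic_eq_self_iff (p : ℝ) :
    Fdiabolic p = p ↔ (p = 0 ∨ ∃ n : ℤ, n ≠ 0 ∧ p = 1 / (n : ℝ)) := by
  rcases eq_or_ne p 0 with rfl | hp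
  · simp [Fdiabolic_zero]
  have hsin : Fdiabolic p = p ↔ Real.sin (Real.pi / p) = 0 := by
    rw [Fdiabolic_of_ne_zero hp, add_eq_left, mul_eq_zero]
    simp [hp]
  rw [hsin, Real.sin_eq_zero_iff, or_iff_right hp]
  refine exists_congr fun n => ?_
  rw [eq_div_iff hp]
  constructor
  · intro h
    have h1 : (n : ℝ) * p = 1 :=
      mul_right_cancel₀ Real.pi_ne_zero (by linear_combination h)
    have hn : (n : ℝ) ≠ 0 := left_ne_zero_of_mul_eq_one h1
    exact ⟨by exact_mod_cast hn, by rw [eq_div_iff hn, mul_comm, h1]⟩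
  · rintro ⟨hn, rfl⟩
    have hn' : (n : ℝ) ≠ 0 := by exact_mod_cast hn
    field_simp

theorem hasDerivAt_Fdiabolic_zero : HasDerivAt Fdiabolic 1 0 := by
  rw [hasDerivAt_iff_isLittleO]
  have hbound : (fun x : ℝ => Fdiabolic x - Fdiabolic 0 - (x - 0) • (1 : ℝ)) =O[nhds 0]
      fun x => x ^ 2 := by
    refine Asymptotics.IsBigO.of_bound 1 (Filter.Eventually.of_forall fun x => ?_)
    rcases eq_or_ne x 0 with rfl | hx
    · simp
    · have heq : Fdiabolic x - Fdiabolic 0 - (x - 0) • (1 : ℝ) =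
          x ^ 2 * Real.sin (Real.pi / x) := by
        rw [Fdiabolic_of_ne_zero hx, Fdiabolic_zero, smul_eq_mul]
        ring
      rw [heq, norm_mul, one_mul]
      exact mul_le_of_le_one_right (norm_nonneg _) (Real.abs_sin_le_one _)
  simpa using hbound.trans_isLittleO (Asymptotics.isLittleO_pow_id one_lt_two)

theorem hasDerivAt_Fdiabolic_of_ne_zero {x : ℝ} (hx : x ≠ 0) :
    HasDerivAt Fdiabolic
      (1 + 2 * x * Real.sin (Real.pi / x) - Real.pi * Real.cos (Real.pi / x)) x := by
  have hinner : HasDerivAt (fun y : ℝ => Real.pi / y) (-Real.pi / x ^ 2) x := by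
    simpa using (hasDerivAt_const x Real.pi).fun_div (hasDerivAt_id x) hx
  have h := (hasDerivAt_id x).fun_add ((hasDerivAt_pow 2 x).fun_mul hinner.sin)
  refine (h.congr_of_eventuallyEq ?_).congr_deriv ?_
  · filter_upwards [eventually_ne_nhds hx] with y hy
    exact Fdiabolic_of_ne_zero hy
  · push_cast
    field_simp
    ring

theorem deriv_Fdiabolic_one_div_intCast {n : ℤ} (hn : n ≠ 0) :
    deriv Fdiabolic (1 / (n : ℝ)) = 1 - (-1 : ℝ) ^ n * Real.pi := by
  have hn' : (n : ℝ) ≠ 0 := by exact_mod_cast hn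
  have harg : Real.pi / (1 / (n : ℝ)) = n * Real.pi := by field_simp
  rw [(hasDerivAt_Fdiabolic_of_ne_zero (one_div_ne_zero hn')).deriv, harg,
    Real.sin_int_mul_pi, Real.cos_int_mul_pi]
  ring

theorem one_lt_abs_deriv_Fdiabolic_one_div_intCast {n : ℤ} (hn : n ≠ 0) :
    1 < |deriv Fdiabolic (1 / (n : ℝ))| := by
  rw [deriv_Fdiabolic_one_div_intCast hn, lt_abs]
  have hpi := Real.pi_gt_three
  rcases Int.even_or_odd n with h | h
  · right
    rw [h.neg_one_zpow]
    linarith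
  · left
    rw [h.neg_one_zpow]
    linarith

theorem one_div_natCast_add_one_mem_unstable (k : ℕ) :
    1 / ((k : ℝ) + 1) ∈ {p : ℝ | Fdiabolic p = p ∧ 1 < |deriv Fdiabolic p|} := by
  have hk : (k : ℤ) + 1 ≠ 0 := by omega
  have hcast : 1 / ((k : ℝ) + 1) = 1 / (((k : ℤ) + 1 : ℤ) : ℝ) := by push_cast; rfl
  rw [hcast]
  exact ⟨(Fdiabolic_eq_self_iff _).2 (Or.inr ⟨_, hk, rfl⟩),
    one_lt_abs_deriv_Fdiabolic_one_div_intCast hk⟩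

/-- (a) the fixed points of `F` are exactly `0` and `1/n` for nonzero
integers `n`; (b) `F` is differentiable with `F'(0) = 1` and `F'(1/n) = 1 − (−1)ⁿ π`, so
`|F'(1/n)| > 1` for all nonzero `n`: `F` has infinitely many hyperbolic linearly unstable
fixed points accumulating at the non-hyperbolic fixed point `0`. -/
theorem fixed_points_and_derivatives_of_diabolic_map :
    (∀ p : ℝ, Fdiabolic p = p ↔ (p = 0 ∨ ∃ n : ℤ, n ≠ 0 ∧ p = 1 / (n : ℝ))) ∧
    Differentiable ℝ Fdiabolic ∧
    deriv Fdiabolic 0 = 1 ∧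
    (∀ n : ℤ, n ≠ 0 → deriv Fdiabolic (1 / (n : ℝ)) = 1 - (-1 : ℝ) ^ n * Real.pi) ∧
    (∀ n : ℤ, n ≠ 0 → 1 < |deriv Fdiabolic (1 / (n : ℝ))|) ∧
    {p : ℝ | Fdiabolic p = p ∧ 1 < |deriv Fdiabolic p|}.Infinite ∧
    AccPt (0 : ℝ) (Filter.principal {p : ℝ | Fdiabolic p = p ∧ 1 < |deriv Fdiabolic p|}) := by
  refine ⟨Fdiabolic_eq_self_iff, fun x => ?_, hasDerivAt_Fdiabolic_zero.deriv,
    fun n hn => deriv_Fdiabolic_one_div_intCast hn,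
    fun n hn => one_lt_abs_deriv_Fdiabolic_one_div_intCast hn,
    Set.infinite_of_injective_forall_mem (f := fun k : ℕ => 1 / ((k : ℝ) + 1)) ?_
      one_div_natCast_add_one_mem_unstable, ?_⟩
  · rcases eq_or_ne x 0 with rfl | hx
    · exact hasDerivAt_Fdiabolic_zero.differentiableAt
    · exact (hasDerivAt_Fdiabolic_of_ne_zero hx).differentiableAt
  · intro a b h
    simpa using h
  · rw [accPt_iff_frequently]
    refine tendsto_one_div_add_atTop_nhds_zero_nat.frequently
      (Filter.Frequently.of_forall fun k => ⟨?_, one_div_natCast_add_one_mem_unstable k⟩)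
    positivity
end

section
/- The map h : ℝ → ℝ defined by h(t) = (3/4)t + (1/4)·tanh((7/4)t + 1/20) has at least three fixed points: one in the interval (−0.95, −0.9), one in (−0.1, 0), and one in (0.9, 0.95). Moreover, for every t with |t| ≥ 0.9 one has 0 < h'(t) < 1; in particular the fixed points in (−0.95, −0.9) and (0.9, 0.95) are hyperbolic asymptotically stable. -/
/-- The second-coordinate map `h(t) = (3/4) t + (1/4) tanh((7/4) t + 1/20)` of the leaky
ESN update for input `u₀`. -/
noncomputable def hESN : ℝ → ℝ :=
  fun t => 3 / 4 * t + 1 / 4 * Real.tanh (7 / 4 * t + 1 / 20)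

theorem Real.tanh_eq_exp_two_mul (x : ℝ) :
    Real.tanh x = (Real.exp (2 * x) - 1) / (Real.exp (2 * x) + 1) := by
  have h : Real.exp (2 * x) = Real.exp x * Real.exp x := by rw [← Real.exp_add]; ring_nf
  have hx := Real.exp_pos x
  rw [Real.tanh_eq, h, Real.exp_neg]
  field_simp

theorem Real.lt_tanh_iff {c x : ℝ} :
    c < Real.tanh x ↔ 1 + c < (1 - c) * Real.exp (2 * x) := by
  rw [Real.tanh_eq_exp_two_mul, lt_div_iff₀ (by positivity)]
  constructor <;> intro h <;> linarith

theorem Real.tanh_lt_iff {c x : ℝ} :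
    Real.tanh x < c ↔ (1 - c) * Real.exp (2 * x) < 1 + c := by
  rw [Real.tanh_eq_exp_two_mul, div_lt_iff₀ (by positivity)]
  constructor <;> intro h <;> linarith

theorem Real.exp_three_gt : 19 < Real.exp 3 := by
  have h : Real.exp 3 = Real.exp 1 ^ 3 := by rw [← Real.exp_nat_mul]; norm_num
  rw [h]
  calc (19 : ℝ) < 2.7182818283 ^ 3 := by norm_num
    _ < Real.exp 1 ^ 3 := by gcongr; exact Real.exp_one_gt_d9

theorem Real.exp_seven_halves_lt : Real.exp (7 / 2) < 39 := by
  have h : Real.exp (7 / 2) ^ 2 = Real.exp 1 ^ 7 := by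
    rw [← Real.exp_nat_mul, ← Real.exp_nat_mul]; norm_num
  refine lt_of_pow_lt_pow_left₀ 2 (by norm_num) ?_
  rw [h]
  calc Real.exp 1 ^ 7 < 2.7182818286 ^ 7 := by gcongr; exact Real.exp_one_lt_d9
    _ < 39 ^ 2 := by norm_num

theorem Real.nine_tenths_lt_tanh {x : ℝ} (hx : 3 / 2 ≤ x) : 0.9 < Real.tanh x := by
  rw [Real.lt_tanh_iff]
  have h : Real.exp 3 ≤ Real.exp (2 * x) := Real.exp_le_exp.2 (by linarith)
  linarith [Real.exp_three_gt]

theorem Real.tanh_lt_nineteen_twentieths {x : ℝ} (hx : x ≤ 7 / 4) : Real.tanh x < 0.95 := by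
  rw [Real.tanh_lt_iff]
  have h : Real.exp (2 * x) ≤ Real.exp (7 / 2) := Real.exp_le_exp.2 (by linarith)
  linarith [Real.exp_seven_halves_lt]

theorem Real.hasDerivAt_tanh_cosh (x : ℝ) :
    HasDerivAt Real.tanh (1 / Real.cosh x ^ 2) x := by
  have hc := (Real.cosh_pos x).ne'
  have h := (Real.hasDerivAt_sinh x).fun_div (Real.hasDerivAt_cosh x) hc
  have hnum : Real.cosh x * Real.cosh x - Real.sinh x * Real.sinh x = 1 := by
    linear_combination Real.cosh_sq x
  rwa [hnum, ← funext Real.tanh_eq_sinh_div_cosh] at h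

theorem Real.one_add_sq_le_cosh_sq (x : ℝ) : 1 + x ^ 2 ≤ Real.cosh x ^ 2 := by
  have h : |x| ≤ |Real.sinh x| := by
    rw [Real.abs_sinh]
    exact Real.self_le_sinh_iff.2 (abs_nonneg x)
  linarith [Real.cosh_sq x, sq_le_sq.2 h]

theorem hasDerivAt_hESN (t : ℝ) :
    HasDerivAt hESN (3 / 4 + 7 / 16 * (1 / Real.cosh (7 / 4 * t + 1 / 20) ^ 2)) t := by
  have hu : HasDerivAt (fun s : ℝ => 7 / 4 * s + 1 / 20) (7 / 4) t := by
    simpa using ((hasDerivAt_id t).const_mul (7 / 4 : ℝ)).add_const (1 / 20 : ℝ)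
  have h := ((hasDerivAt_id t).const_mul (3 / 4 : ℝ)).add
    (((Real.hasDerivAt_tanh_cosh (7 / 4 * t + 1 / 20)).comp t hu).const_mul (1 / 4 : ℝ))
  exact h.congr_deriv (by ring)

theorem continuous_hESN : Continuous hESN :=
  continuous_iff_continuousAt.2 fun t => (hasDerivAt_hESN t).continuousAt

theorem deriv_hESN_mem_Ioo {t : ℝ} (ht : 0.9 ≤ |t|) : deriv hESN t ∈ Set.Ioo 0 1 := by
  rw [(hasDerivAt_hESN t).deriv]
  have hcosh : 7 / 4 < Real.cosh (7 / 4 * t + 1 / 20) ^ 2 := by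
    refine lt_of_lt_of_le ?_ (Real.one_add_sq_le_cosh_sq _)
    rcases le_abs.1 ht with h | h <;> norm_num at h <;> nlinarith
  refine ⟨by positivity, ?_⟩
  have : 1 / Real.cosh (7 / 4 * t + 1 / 20) ^ 2 < 4 / 7 := by
    rw [div_lt_iff₀ (by linarith)]
    linarith
  linarith

theorem exists_fixedPoint_of_lt_of_gt {f : ℝ → ℝ} (hf : Continuous f) {a b : ℝ} (hab : a ≤ b)
    (ha : f a < a) (hb : b < f b) : ∃ c ∈ Set.Ioo a b, f c = c := by
  obtain ⟨c, hc, h⟩ := intermediate_value_Ioo hab (hf.sub continuous_id).continuousOn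
    (show (0 : ℝ) ∈ Set.Ioo (f a - a) (f b - b) from ⟨by linarith, by linarith⟩)
  exact ⟨c, hc, sub_eq_zero.1 h⟩

theorem exists_fixedPoint_of_gt_of_lt {f : ℝ → ℝ} (hf : Continuous f) {a b : ℝ} (hab : a ≤ b)
    (ha : a < f a) (hb : f b < b) : ∃ c ∈ Set.Ioo a b, f c = c := by
  obtain ⟨c, hc, h⟩ := intermediate_value_Ioo' hab (hf.sub continuous_id).continuousOn
    (show (0 : ℝ) ∈ Set.Ioo (f b - b) (f a - a) from ⟨by linarith, by linarith⟩)
  exact ⟨c, hc, sub_eq_zero.1 h⟩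

theorem hESN_lt_iff {t : ℝ} : hESN t < t ↔ Real.tanh (7 / 4 * t + 1 / 20) < t := by
  unfold hESN
  constructor <;> intro h <;> linarith

theorem lt_hESN_iff {t : ℝ} : t < hESN t ↔ t < Real.tanh (7 / 4 * t + 1 / 20) := by
  unfold hESN
  constructor <;> intro h <;> linarith

/-- `h` has at least three fixed points, one in each of `(−0.95, −0.9)`,
`(−0.1, 0)` and `(0.9, 0.95)`; moreover `0 < h'(t) < 1` whenever `|t| ≥ 0.9`, so the outer
two fixed points are hyperbolic asymptotically stable. -/
theorem hESN_three_fixed_points_and_stability :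
    (∃ a ∈ Set.Ioo (-0.95 : ℝ) (-0.9), hESN a = a) ∧
    (∃ b ∈ Set.Ioo (-0.1 : ℝ) 0, hESN b = b) ∧
    (∃ c ∈ Set.Ioo (0.9 : ℝ) 0.95, hESN c = c) ∧
    (∀ t : ℝ, 0.9 ≤ |t| → 0 < deriv hESN t ∧ deriv hESN t < 1) ∧
    (∀ p : ℝ, (p ∈ Set.Ioo (-0.95 : ℝ) (-0.9) ∨ p ∈ Set.Ioo (0.9 : ℝ) 0.95) →
      hESN p = p → |deriv hESN p| < 1) := by
  refine ⟨exists_fixedPoint_of_gt_of_lt continuous_hESN (by norm_num) ?_ ?_,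
    exists_fixedPoint_of_lt_of_gt continuous_hESN (by norm_num) ?_ ?_,
    exists_fixedPoint_of_gt_of_lt continuous_hESN (by norm_num) ?_ ?_,
    fun t ht => deriv_hESN_mem_Ioo ht, fun p hp _ => ?_⟩
  · rw [lt_hESN_iff, ← neg_neg (7 / 4 * _ + _), Real.tanh_neg, neg_lt_neg_iff]
    exact Real.tanh_lt_nineteen_twentieths (by norm_num)
  · rw [hESN_lt_iff, ← neg_neg (7 / 4 * _ + _), Real.tanh_neg, neg_lt_neg_iff]
    exact Real.nine_tenths_lt_tanh (by norm_num)
  · rw [hESN_lt_iff, ← neg_neg (7 / 4 * _ + _), Real.tanh_neg, neg_lt_neg_iff, Real.lt_tanh_iff]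
    norm_num
    linarith [Real.add_one_le_exp (1 / 4 : ℝ)]
  · rw [lt_hESN_iff, Real.lt_tanh_iff]
    norm_num
  · rw [lt_hESN_iff]
    exact Real.nine_tenths_lt_tanh (by norm_num)
  · rw [hESN_lt_iff]
    exact Real.tanh_lt_nineteen_twentieths (by norm_num)
  · have hp' : 0.9 ≤ |p| := by
      rcases hp with h | h
      · exact le_abs.2 (Or.inr (by linarith [h.2]))
      · exact le_abs.2 (Or.inl h.1.le)
    obtain ⟨h0, h1⟩ := deriv_hESN_mem_Ioo hp'
    rwa [abs_of_pos h0]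
end

section
/- The map f₁ : ℝ² → ℝ² given coordinatewise by f₁(x₁, x₂) = ((3/4)x₁ + (1/4)·tanh((1/2)x₁ − 1/4), (3/4)x₂ + (1/4)·tanh((7/4)x₂ − 1/2)) maps the square [−1,0] × [−1,0] into itself; consequently f₁ has a fixed point in [−1,0] × [−1,0], and every fixed point of f₁ in [−1,0] × [−1,0] has both coordinates strictly negative. -/
/-- The leaky ESN update map `f₁` for input `u₁ = (−1/4, −1/2)`, with leak rate `1/4` and
reservoir matrix `diag(1/2, 7/4)`. -/
noncomputable def fOne : ℝ × ℝ → ℝ × ℝ :=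
  fun p => (3 / 4 * p.1 + 1 / 4 * Real.tanh (1 / 2 * p.1 - 1 / 4),
            3 / 4 * p.2 + 1 / 4 * Real.tanh (7 / 4 * p.2 - 1 / 2))

namespace Real

theorem tanh_neg_of_neg {x : ℝ} (hx : x < 0) : tanh x < 0 := by
  rw [tanh_eq_sinh_div_cosh]
  exact div_neg_of_neg_of_pos (sinh_neg_iff.mpr hx) (cosh_pos x)

theorem continuous_tanh : Continuous tanh := by
  simp only [funext tanh_eq_sinh_div_cosh]
  exact continuous_sinh.div continuous_cosh fun x => (cosh_pos x).ne'

end Real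

/-- One coordinate of the leaky update, with leak rate `1/4`, weight `w` and input `-b`. -/
noncomputable def leakyTanh (w b x : ℝ) : ℝ :=
  3 / 4 * x + 1 / 4 * Real.tanh (w * x - b)

section LeakyTanh

variable {w b : ℝ}

theorem continuous_leakyTanh (w b : ℝ) : Continuous (leakyTanh w b) := by
  have := Real.continuous_tanh
  unfold leakyTanh
  fun_prop

theorem tanh_mul_sub_neg {x : ℝ} (hw : 0 ≤ w) (hb : 0 < b) (hx : x ≤ 0) :
    Real.tanh (w * x - b) < 0 :=
  Real.tanh_neg_of_neg (by linarith [mul_nonpos_of_nonneg_of_nonpos hw hx])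

theorem leakyTanh_mapsTo (hw : 0 ≤ w) (hb : 0 < b) :
    Set.MapsTo (leakyTanh w b) (Set.Icc (-1) 0) (Set.Icc (-1) 0) := by
  rintro x ⟨hx₁, hx₀⟩
  have h := tanh_mul_sub_neg hw hb hx₀
  have h' := Real.neg_one_lt_tanh (w * x - b)
  unfold leakyTanh
  constructor <;> linarith

theorem exists_leakyTanh_eq_self (hw : 0 ≤ w) (hb : 0 < b) :
    ∃ x ∈ Set.Icc (-1 : ℝ) 0, leakyTanh w b x = x :=
  exists_mem_Icc_isFixedPt_of_mapsTo (continuous_leakyTanh w b).continuousOn (by norm_num)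
    (leakyTanh_mapsTo hw hb)

theorem neg_of_leakyTanh_eq_self {x : ℝ} (hw : 0 ≤ w) (hb : 0 < b) (hx : x ≤ 0)
    (h : leakyTanh w b x = x) : x < 0 := by
  have := tanh_mul_sub_neg hw hb hx
  unfold leakyTanh at h
  linarith

end LeakyTanh

theorem fOne_eq_prodMap : fOne = Prod.map (leakyTanh (1 / 2) (1 / 4)) (leakyTanh (7 / 4) (1 / 2)) :=
  rfl

/-- `f₁` maps the square `[−1,0] × [−1,0]` into itself; consequently it has
a fixed point there, and every fixed point of `f₁` in that square has both coordinates
strictly negative. -/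
theorem fOne_maps_square_and_fixed_point_negative :
    Set.MapsTo fOne (Set.Icc (-1 : ℝ) 0 ×ˢ Set.Icc (-1 : ℝ) 0)
      (Set.Icc (-1 : ℝ) 0 ×ˢ Set.Icc (-1 : ℝ) 0) ∧
    (∃ p ∈ Set.Icc (-1 : ℝ) 0 ×ˢ Set.Icc (-1 : ℝ) 0, fOne p = p) ∧
    (∀ p ∈ Set.Icc (-1 : ℝ) 0 ×ˢ Set.Icc (-1 : ℝ) 0, fOne p = p →
      p.1 < 0 ∧ p.2 < 0) := by
  have hw₁ : (0 : ℝ) ≤ 1 / 2 := by norm_num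
  have hb₁ : (0 : ℝ) < 1 / 4 := by norm_num
  have hw₂ : (0 : ℝ) ≤ 7 / 4 := by norm_num
  have hb₂ : (0 : ℝ) < 1 / 2 := by norm_num
  rw [fOne_eq_prodMap]
  refine ⟨(leakyTanh_mapsTo hw₁ hb₁).prodMap (leakyTanh_mapsTo hw₂ hb₂), ?_, ?_⟩
  · obtain ⟨x, hx, hfx⟩ := exists_leakyTanh_eq_self hw₁ hb₁
    obtain ⟨y, hy, hfy⟩ := exists_leakyTanh_eq_self hw₂ hb₂
    exact ⟨(x, y), ⟨hx, hy⟩, Prod.ext hfx hfy⟩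
  · rintro p ⟨hp₁, hp₂⟩ h
    exact ⟨neg_of_leakyTanh_eq_self hw₁ hb₁ hp₁.2 (congrArg Prod.fst h),
      neg_of_leakyTanh_eq_self hw₂ hb₂ hp₂.2 (congrArg Prod.snd h)⟩
end
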